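/- arXiv:2402.07753 — 3 statements merged into one kernel-verified Lean document; each statement's English description precedes it below -/
import Mathlib

section
/- Let C = (V_c, E_c, w) be a cactus graph with at least 2 vertices, let L_c be a link set on V_c with costs c, and suppose that some feasible augmentation of C exists. Then every minimum spanning forest F of the link graph (V_c, L_c) is a feasible augmentation of C. -/
open scoped Classical

namespace WCAP

variable {V : Type*}

/-- `e` crosses (covers) the cut `A` iff exactly one endpoint of `e` lies in `A`. -/
def Crosses (A : Set V) (e : Sym2 V) : Prop :=
  ∃ u v, e = s(u, v) ∧ u ∈ A ∧ v ∉ A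

/-- A cut of a graph on vertex set `V` is a nonempty proper subset of `V`. -/
def IsCut (A : Set V) : Prop :=
  A.Nonempty ∧ A ≠ Set.univ

/-- The weight of the cut `A`: the sum of the weights of all edges with exactly one
endpoint in `A`. -/
noncomputable def cutWeight (G : SimpleGraph V) (w : Sym2 V → ℝ) (A : Set V) : ℝ :=
  ∑ᶠ e ∈ {e : Sym2 V | e ∈ G.edgeSet ∧ Crosses A e}, w e

/-- The edge connectivity of `(G, w)`: the minimum weight of a cut. -/
noncomputable def edgeConn (G : SimpleGraph V) (w : Sym2 V → ℝ) : ℝ :=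
  sInf {x : ℝ | ∃ A : Set V, IsCut A ∧ cutWeight G w A = x}

/-- A minimum cut: a cut whose weight equals the edge connectivity. -/
def IsMinCut (G : SimpleGraph V) (w : Sym2 V → ℝ) (A : Set V) : Prop :=
  IsCut A ∧ cutWeight G w A = edgeConn G w

/-- The graph `G + S` obtained from `G` by adding the links of `S` as edges. -/
def addLinks (G : SimpleGraph V) (S : Set (Sym2 V)) : SimpleGraph V :=
  G ⊔ SimpleGraph.fromEdgeSet S

/-- The weight function of `G + S`: edges of `G` keep their weight, added links get
weight `1`. -/
noncomputable def augWeight (G : SimpleGraph V) (w : Sym2 V → ℝ) : Sym2 V → ℝ :=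
  fun e => if e ∈ G.edgeSet then w e else 1

/-- `S` is a feasible augmentation of `(G, w)` if adding the links of `S` (with weight 1)
strictly increases the edge connectivity. -/
def IsFeasibleAug (G : SimpleGraph V) (w : Sym2 V → ℝ) (S : Set (Sym2 V)) : Prop :=
  edgeConn G w < edgeConn (addLinks G S) (augWeight G w)

/-- `F` is a spanning forest of the link graph `(V, L)`: `F ⊆ L`, the graph `(V, F)`
is acyclic, and `(V, F)` has the same connected components as `(V, L)`. -/
def IsSpanningForest (L F : Set (Sym2 V)) : Prop :=
  F ⊆ L ∧ (SimpleGraph.fromEdgeSet F).IsAcyclic ∧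
    ∀ u v : V, (SimpleGraph.fromEdgeSet F).Reachable u v ↔
      (SimpleGraph.fromEdgeSet L).Reachable u v

/-- Total cost of a set of links. -/
noncomputable def linkCost (c : Sym2 V → ℝ) (F : Set (Sym2 V)) : ℝ :=
  ∑ᶠ l ∈ F, c l

/-- A minimum spanning forest of the link graph `(V, L)` w.r.t. costs `c`. -/
def IsMinSpanningForest (c : Sym2 V → ℝ) (L F : Set (Sym2 V)) : Prop :=
  IsSpanningForest L F ∧
    ∀ F' : Set (Sym2 V), IsSpanningForest L F' → linkCost c F ≤ linkCost c F'

/-- A cactus graph: a connected graph in which any two distinct cycles (cycles with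
different edge sets) share at most one vertex. -/
def IsCactus (G : SimpleGraph V) : Prop :=
  G.Connected ∧ ∀ ⦃u v : V⦄ (p : G.Walk u u) (q : G.Walk v v),
    p.IsCycle → q.IsCycle →
      (∀ e : Sym2 V, e ∈ p.edges ↔ e ∈ q.edges) ∨
      (∀ a b : V, a ∈ p.support → a ∈ q.support → b ∈ p.support → b ∈ q.support → a = b)

theorem Crosses.not_isDiag {A : Set V} {e : Sym2 V} (h : Crosses A e) : ¬ e.IsDiag := by
  obtain ⟨u, v, rfl, hu, hv⟩ := h
  intro h
  exact hv (Sym2.mk_isDiag_iff.1 h ▸ hu)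

/-- If no link of `F` crosses `A`, then `A` is a union of components of `(V, F)`. -/
theorem mem_of_reachable {F : Set (Sym2 V)} {A : Set V} (hA : ∀ e ∈ F, ¬ Crosses A e)
    {u v : V} (h : (SimpleGraph.fromEdgeSet F).Reachable u v) (hu : u ∈ A) : v ∈ A := by
  obtain ⟨p⟩ := h
  induction p with
  | nil => exact hu
  | cons hadj _ ih =>
    refine ih ?_
    by_contra hv
    exact hA _ ((SimpleGraph.fromEdgeSet_adj F).1 hadj).1 ⟨_, _, rfl, hu, hv⟩

/-- A spanning forest of `(V, L)` covers every cut covered by `L`. -/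
theorem IsSpanningForest.exists_crosses {L F : Set (Sym2 V)} (hF : IsSpanningForest L F)
    {A : Set V} {e : Sym2 V} (he : e ∈ L) (hA : Crosses A e) : ∃ f ∈ F, Crosses A f := by
  by_contra! h
  obtain ⟨u, v, rfl, hu, hv⟩ := hA
  have hadj : (SimpleGraph.fromEdgeSet L).Adj u v :=
    (SimpleGraph.fromEdgeSet_adj L).2 ⟨he, fun huv => hv (huv ▸ hu)⟩
  exact hv (mem_of_reachable h ((hF.2.2 u v).2 hadj.reachable) hu)

theorem cutWeight_addLinks [Finite V] (G : SimpleGraph V) (w : Sym2 V → ℝ)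
    {S : Set (Sym2 V)} (hS : Disjoint S G.edgeSet) (A : Set V) :
    cutWeight (addLinks G S) (augWeight G w) A =
      cutWeight G w A + ({e | e ∈ S ∧ Crosses A e}.ncard : ℝ) := by
  have hunion : {e : Sym2 V | e ∈ (addLinks G S).edgeSet ∧ Crosses A e} =
      {e | e ∈ G.edgeSet ∧ Crosses A e} ∪ {e | e ∈ S ∧ Crosses A e} := by
    ext e
    simp only [addLinks, SimpleGraph.edgeSet_sup, SimpleGraph.edgeSet_fromEdgeSet,
      Set.mem_ofPred_eq, Set.mem_union, Set.mem_sdiff]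
    constructor
    · rintro ⟨h | h, hA⟩
      · exact Or.inl ⟨h, hA⟩
      · exact Or.inr ⟨h.1, hA⟩
    · rintro (⟨h, hA⟩ | ⟨h, hA⟩)
      · exact ⟨Or.inl h, hA⟩
      · exact ⟨Or.inr ⟨h, hA.not_isDiag⟩, hA⟩
  have hdisj : Disjoint {e : Sym2 V | e ∈ G.edgeSet ∧ Crosses A e}
      {e | e ∈ S ∧ Crosses A e} :=
    hS.symm.mono (fun _ h => h.1) (fun _ h => h.1)
  unfold cutWeight
  rw [hunion, finsum_mem_union hdisj (Set.toFinite _) (Set.toFinite _)]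
  congr 1
  · exact finsum_mem_congr rfl fun e he => if_pos he.1
  · have hone : ∀ e ∈ {e | e ∈ S ∧ Crosses A e}, augWeight G w e = 1 :=
      fun e he => if_neg (Set.disjoint_left.1 hS he.1)
    rw [finsum_mem_congr rfl hone, finsum_mem_eq_finite_toFinset_sum _ (Set.toFinite _),
      Finset.sum_const, nsmul_eq_mul, mul_one, Set.ncard_eq_toFinset_card _ (Set.toFinite _)]

theorem edgeConn_le_cutWeight [Finite V] (G : SimpleGraph V) (w : Sym2 V → ℝ)
    {A : Set V} (hA : IsCut A) : edgeConn G w ≤ cutWeight G w A :=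
  csInf_le (((Set.toFinite {A : Set V | IsCut A}).image (cutWeight G w)).bddBelow) ⟨A, hA, rfl⟩

theorem exists_isMinCut [Finite V] [Nontrivial V] (G : SimpleGraph V) (w : Sym2 V → ℝ) :
    ∃ A, IsMinCut G w A := by
  obtain ⟨x, y, hxy⟩ := exists_pair_ne V
  have hcut : IsCut ({x} : Set V) :=
    ⟨Set.singleton_nonempty x, fun h => hxy.symm (h.symm ▸ Set.mem_univ y : y ∈ ({x} : Set V))⟩
  obtain ⟨A, hA, h⟩ := Set.Nonempty.csInf_mem (Set.Nonempty.image (cutWeight G w) ⟨_, hcut⟩)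
    ((Set.toFinite {A : Set V | IsCut A}).image (cutWeight G w))
  exact ⟨A, hA, h⟩

/-- A link set is a feasible augmentation iff it covers every minimum cut. -/
theorem isFeasibleAug_iff [Finite V] [Nontrivial V] (G : SimpleGraph V) (w : Sym2 V → ℝ)
    {S : Set (Sym2 V)} (hS : Disjoint S G.edgeSet) :
    IsFeasibleAug G w S ↔ ∀ A, IsMinCut G w A → ∃ e ∈ S, Crosses A e := by
  constructor
  · intro h A hA
    have hlt := h.trans_le (edgeConn_le_cutWeight (addLinks G S) (augWeight G w) hA.1)
    rw [cutWeight_addLinks G w hS, hA.2, lt_add_iff_pos_right, Nat.cast_pos,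
      Set.ncard_pos] at hlt
    exact hlt
  · intro h
    obtain ⟨A, hA, hAw⟩ := exists_isMinCut (addLinks G S) (augWeight G w)
    unfold IsFeasibleAug
    rw [← hAw, cutWeight_addLinks G w hS]
    rcases (edgeConn_le_cutWeight G w hA).lt_or_eq with hlt | heq
    · exact hlt.trans_le (le_add_of_nonneg_right (Nat.cast_nonneg _))
    · rw [heq, lt_add_iff_pos_right, Nat.cast_pos, Set.ncard_pos]
      exact h A ⟨hA, heq.symm⟩

/-- every minimum spanning forest of the link graph of a cactus (that admits
some feasible augmentation) is itself a feasible augmentation. -/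
theorem mst_is_feasible_augmentation
    [Fintype V] (C : SimpleGraph V) (w : Sym2 V → ℝ)
    (hV : 2 ≤ Fintype.card V) (hcactus : IsCactus C)
    (hw : ∀ e ∈ C.edgeSet, 0 < w e)
    (L : Set (Sym2 V)) (c : Sym2 V → ℝ)
    (hLdiag : ∀ l ∈ L, ¬ l.IsDiag) (hLdisj : Disjoint L C.edgeSet)
    (hc : ∀ l ∈ L, 0 ≤ c l)
    (hfeas : ∃ S : Set (Sym2 V), S ⊆ L ∧ IsFeasibleAug C w S)
    (F : Set (Sym2 V)) (hF : IsMinSpanningForest c L F) :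
    IsFeasibleAug C w F := by
  have : Nontrivial V := Fintype.one_lt_card_iff_nontrivial.1 hV
  obtain ⟨S, hSL, hS⟩ := hfeas
  rw [isFeasibleAug_iff C w (hLdisj.mono_left hSL)] at hS
  rw [isFeasibleAug_iff C w (hLdisj.mono_left hF.1.1)]
  intro A hA
  obtain ⟨e, he, hAe⟩ := hS A hA
  exact hF.1.exists_crosses (hSL he) hAe
end WCAP
end

section
/- Let C be a cactus graph on at least 2 vertices and let k > 0. Assign to every bridge of C the weight k and to every cycle edge of C the weight k/2. Then the edge connectivity of the resulting edge-weighted graph equals k. -/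
open scoped Classical

namespace WCAP

variable {V : Type*}

/-- `e` lies on a cycle of `G` (then `e` is a cycle edge; otherwise it is a bridge). -/
def OnCycle (G : SimpleGraph V) (e : Sym2 V) : Prop :=
  ∃ (u : V) (p : G.Walk u u), p.IsCycle ∧ e ∈ p.edges

/-- A walk between two vertices separated by `A` uses an edge crossing `A`. -/
theorem exists_mem_edgeSet_crosses {G : SimpleGraph V} {A : Set V} {u v : V}
    (h : G.Reachable u v) (hu : u ∈ A) (hv : v ∉ A) : ∃ e ∈ G.edgeSet, Crosses A e := by
  obtain ⟨p⟩ := h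
  obtain ⟨d, -, h₁, h₂⟩ := p.exists_boundary_dart A hu hv
  exact ⟨s(d.fst, d.snd), d.adj, d.fst, d.snd, rfl, h₁, h₂⟩

theorem onCycle_iff_not_isBridge {G : SimpleGraph V} {e : Sym2 V} (he : e ∈ G.edgeSet) :
    OnCycle G e ↔ ¬ G.IsBridge e := by
  rw [SimpleGraph.isBridge_iff_forall_cycle_notMem he, OnCycle]
  push Not
  rfl

theorem cutWeight_eq_sum [Fintype V] (G : SimpleGraph V) (w : Sym2 V → ℝ) (A : Set V) :
    cutWeight G w A =
      ∑ e ∈ {e : Sym2 V | e ∈ G.edgeSet ∧ Crosses A e}.toFinset, w e :=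
  finsum_mem_eq_toFinset_sum _ _

/-- Summing the weights of any set of crossing edges bounds the cut weight from below. -/
theorem sum_le_cutWeight [Fintype V] {G : SimpleGraph V} {w : Sym2 V → ℝ} {A : Set V}
    (hw : ∀ e ∈ G.edgeSet, 0 ≤ w e) {F : Finset (Sym2 V)}
    (hF : ∀ e ∈ F, e ∈ G.edgeSet ∧ Crosses A e) : ∑ e ∈ F, w e ≤ cutWeight G w A := by
  rw [cutWeight_eq_sum]
  refine Finset.sum_le_sum_of_subset_of_nonneg (fun e he => by simpa using hF e he) ?_
  intro e he _
  exact hw e (by simpa using (Set.mem_toFinset.1 he).1)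

/-- If every crossing edge lies in `F`, the cut weight is at most the weight of `F`. -/
theorem cutWeight_le_sum [Fintype V] {G : SimpleGraph V} {w : Sym2 V → ℝ} {A : Set V}
    {F : Finset (Sym2 V)} (hw : ∀ e ∈ F, 0 ≤ w e)
    (hF : ∀ e ∈ G.edgeSet, Crosses A e → e ∈ F) : cutWeight G w A ≤ ∑ e ∈ F, w e := by
  rw [cutWeight_eq_sum]
  refine Finset.sum_le_sum_of_subset_of_nonneg (fun e he => ?_) fun e he _ => hw e he
  have := Set.mem_toFinset.1 he
  exact hF e this.1 this.2

/-- A bridge `f` of a graph `H` yields a cut which no edge of `H` other than `f` crosses. -/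
theorem exists_isCut_of_isBridge {H : SimpleGraph V} {f : Sym2 V} (hf : H.IsBridge f) :
    ∃ A : Set V, IsCut A ∧ ∀ e ∈ H.edgeSet, Crosses A e → e = f := by
  induction f with | _ x y
  rw [SimpleGraph.isBridge_iff] at hf
  refine ⟨{z | (H.deleteEdges {s(x, y)}).Reachable x z}, ⟨⟨x, .refl x⟩, fun h => ?_⟩, ?_⟩
  · exact hf (h ▸ Set.mem_univ y : y ∈ {z | (H.deleteEdges {s(x, y)}).Reachable x z})
  · rintro e he ⟨u, v, rfl, hu, hv⟩
    by_contra hne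
    refine hv (SimpleGraph.Reachable.trans hu (SimpleGraph.Adj.reachable ?_))
    exact SimpleGraph.deleteEdges_adj.2 ⟨he, by simpa using hne⟩

/-- In a cactus, deleting an edge of a cycle turns the other edges of the cycle into bridges. -/
theorem IsCactus.isBridge_deleteEdges {C : SimpleGraph V} (hC : IsCactus C) {u : V}
    {p : C.Walk u u} (hp : p.IsCycle) {e f : Sym2 V} (he : e ∈ p.edges) (hf : f ∈ p.edges)
    (hne : f ≠ e) : (C.deleteEdges {e}).IsBridge f := by
  have hfC : f ∈ (C.deleteEdges {e}).edgeSet := by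
    rw [SimpleGraph.edgeSet_deleteEdges]
    exact ⟨p.edges_subset_edgeSet hf, hne⟩
  rw [SimpleGraph.isBridge_iff_forall_cycle_notMem hfC]
  intro v q hq hfq
  have hle : C.deleteEdges {e} ≤ C := SimpleGraph.deleteEdges_le _
  have hedges : (q.mapLe hle).edges = q.edges := by simp
  rcases hC.2 p (q.mapLe hle) hp (hq.mapLe hle) with h | h
  · have heq := (h e).1 he
    rw [hedges] at heq
    have := q.edges_subset_edgeSet heq
    simp at this
  · rw [← hedges] at hfq
    induction f with | _ x y
    exact (p.adj_of_mem_edges hf).ne (h x y (p.fst_mem_support_of_mem_edges hf)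
      (SimpleGraph.Walk.fst_mem_support_of_mem_edges _ hfq)
      (p.snd_mem_support_of_mem_edges hf)
      (SimpleGraph.Walk.snd_mem_support_of_mem_edges _ hfq))

/-- A cycle through `e` has an edge other than `e`. -/
theorem exists_mem_edges_ne {G : SimpleGraph V} {u : V} {p : G.Walk u u} (hp : p.IsCycle)
    (e : Sym2 V) : ∃ f ∈ p.edges, f ≠ e := by
  by_contra! h
  have hsub : p.edges.toFinset ⊆ {e} := fun f hf => by
    simpa using h f (List.mem_toFinset.1 hf)
  have hcard := Finset.card_le_card hsub
  rw [List.toFinset_card_of_nodup hp.edges_nodup, SimpleGraph.Walk.length_edges,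
    Finset.card_singleton] at hcard
  have := hp.three_le_length
  omega

/-- In a connected graph whose bridges weigh at least `k` and whose other edges weigh at least
`k / 2`, every cut weighs at least `k`. -/
theorem le_cutWeight [Fintype V] {G : SimpleGraph V} (hG : G.Connected) {k : ℝ} (hk : 0 ≤ k)
    {w : Sym2 V → ℝ} (hbridge : ∀ e ∈ G.edgeSet, G.IsBridge e → k ≤ w e)
    (hw : ∀ e ∈ G.edgeSet, k / 2 ≤ w e) {A : Set V} (hA : IsCut A) : k ≤ cutWeight G w A := by
  have hw0 : ∀ e ∈ G.edgeSet, 0 ≤ w e := fun e he => (div_nonneg hk zero_le_two).trans (hw e he)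
  obtain ⟨⟨a, ha⟩, hne⟩ := hA
  obtain ⟨b, hb⟩ := (Set.ne_univ_iff_exists_notMem A).1 hne
  obtain ⟨e, he, hcross⟩ := exists_mem_edgeSet_crosses (hG.preconnected a b) ha hb
  by_cases hbr : G.IsBridge e
  · have := sum_le_cutWeight (F := {e}) hw0 (by simpa using ⟨he, hcross⟩)
    rw [Finset.sum_singleton] at this
    exact (hbridge e he hbr).trans this
  · have hconn : (G.deleteEdges {e}).Connected := by
      induction e with | _ x y
      exact hG.connected_delete_edge_of_not_isBridge hbr
    obtain ⟨f, hf, hfcross⟩ := exists_mem_edgeSet_crosses (hconn.preconnected a b) ha hb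
    rw [SimpleGraph.edgeSet_deleteEdges] at hf
    have hfe : e ≠ f := fun h => hf.2 h.symm
    have := sum_le_cutWeight (F := {e, f}) (A := A) hw0 (by
      intro g hg
      rcases Finset.mem_insert.1 hg with rfl | hg
      · exact ⟨he, hcross⟩
      · rw [Finset.mem_singleton.1 hg]
        exact ⟨hf.1, hfcross⟩)
    rw [Finset.sum_pair hfe] at this
    linarith [hw e he, hw f hf.1]

/-- weighting the bridges of a cactus by `k > 0` and its cycle edges by
`k/2` yields an edge-weighted graph of edge connectivity exactly `k`. -/
theorem cactus_weighted_connectivity [Fintype V] (C : SimpleGraph V)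
    (hV : 2 ≤ Fintype.card V) (hcactus : IsCactus C)
    (k : ℝ) (hk : 0 < k) (w : Sym2 V → ℝ)
    (hbridge : ∀ e ∈ C.edgeSet, ¬ OnCycle C e → w e = k)
    (hcycle : ∀ e ∈ C.edgeSet, OnCycle C e → w e = k / 2) :
    edgeConn C w = k := by
  have hw : ∀ e ∈ C.edgeSet, k / 2 ≤ w e := fun e he => by
    by_cases hc : OnCycle C e
    · exact (hcycle e he hc).ge
    · rw [hbridge e he hc]
      linarith
  have hlower : ∀ A : Set V, IsCut A → k ≤ cutWeight C w A := fun A hA =>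
    le_cutWeight hcactus.1 hk.le
      (fun e he hb => (hbridge e he fun hc => (onCycle_iff_not_isBridge he).1 hc hb).ge) hw hA
  have hupper : ∃ A : Set V, IsCut A ∧ cutWeight C w A ≤ k := by
    have : Nontrivial V := Fintype.one_lt_card_iff_nontrivial.1 hV
    obtain ⟨a, b, hab⟩ := exists_pair_ne V
    obtain ⟨e, he, -⟩ := exists_mem_edgeSet_crosses (A := {a})
      (hcactus.1.preconnected a b) rfl hab.symm
    by_cases hc : OnCycle C e
    · obtain ⟨u, p, hp, hep⟩ := id hc
      obtain ⟨f, hfp, hfe⟩ := exists_mem_edges_ne hp e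
      have hf := p.edges_subset_edgeSet hfp
      have hwf : w f = k / 2 := hcycle f hf ⟨u, p, hp, hfp⟩
      have hwe : w e = k / 2 := hcycle e he hc
      obtain ⟨A, hA, hcross⟩ :=
        exists_isCut_of_isBridge (hcactus.isBridge_deleteEdges hp hep hfp hfe)
      have hle := cutWeight_le_sum (G := C) (w := w) (A := A) (F := {e, f})
        (by simp [hwe, hwf, (half_pos hk).le]) (fun g hg hgA => by
          by_cases hge : g = e
          · simp [hge]
          · have := hcross g (by
              rw [SimpleGraph.edgeSet_deleteEdges]
              exact ⟨hg, hge⟩) hgA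
            simp [this])
      rw [Finset.sum_pair hfe.symm, hwe, hwf, add_halves] at hle
      exact ⟨A, hA, hle⟩
    · have hwe : w e = k := hbridge e he hc
      rw [onCycle_iff_not_isBridge he, not_not] at hc
      obtain ⟨A, hA, hcross⟩ := exists_isCut_of_isBridge hc
      have hle := cutWeight_le_sum (G := C) (w := w) (A := A) (F := {e})
        (by simp [hwe, hk.le]) (fun g hg hgA => by simp [hcross g hg hgA])
      rw [Finset.sum_singleton, hwe] at hle
      exact ⟨A, hA, hle⟩
  obtain ⟨A, hA, hle⟩ := hupper
  refine IsLeast.csInf_eq ⟨⟨A, hA, hle.antisymm (hlower A hA)⟩, ?_⟩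
  rintro x ⟨B, hB, rfl⟩
  exact hlower B hB
end WCAP
end

section
/- Let H = (V, F) be a finite simple graph with maximum degree Δ and let S ⊆ F. For every odd integer k ≥ 3, the number of paths in H with exactly k edges that are alternating with respect to S and whose first and last edges do not belong to S (counting each path once per direction of traversal) is at most (2|S|)^{(k−1)/2} · Δ². -/
open scoped Classical

namespace WCAP

variable {V : Type*}

theorem ncard_ordered_pairs_le [Fintype V] (S : Set (Sym2 V)) :
    (Finset.univ.filter fun p : V × V => s(p.1, p.2) ∈ S).card ≤ 2 * S.ncard := by
  rw [Set.ncard_eq_toFinset_card', mul_comm]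
  refine le_trans (Finset.card_le_card ?_) (Finset.card_biUnion_le_card_mul S.toFinset
    (fun e => Finset.univ.filter fun p : V × V => s(p.1, p.2) = e) 2 ?_)
  · intro p hp
    simpa using hp
  · intro e _
    induction e using Sym2.ind with
    | _ a b =>
      refine le_trans (Finset.card_le_card (t := {(a, b), (b, a)}) ?_) Finset.card_le_two
      rintro ⟨c, d⟩ h
      simpa [Prod.ext_iff] using h

theorem exists_neighbor_labelling [Fintype V] (H : SimpleGraph V) :
    ∃ f : V → V → ℕ, (∀ v w, H.Adj v w → f v w < H.maxDegree) ∧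
      ∀ v w w', H.Adj v w → H.Adj v w' → f v w = f v w' → w = w' := by
  refine ⟨fun v w => if h : w ∈ H.neighborFinset v then
    ((H.neighborFinset v).equivFin ⟨w, h⟩ : ℕ) else 0, ?_, ?_⟩
  · intro v w h
    have h' : w ∈ H.neighborFinset v := by simpa using h
    simp only [dif_pos h']
    exact lt_of_lt_of_le (Fin.isLt _) (H.degree_le_maxDegree v)
  · intro v w w' h h' heq
    have hw : w ∈ H.neighborFinset v := by simpa using h
    have hw' : w' ∈ H.neighborFinset v := by simpa using h'
    simp only [dif_pos hw, dif_pos hw'] at heq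
    simpa using (H.neighborFinset v).equivFin.injective (Fin.ext heq)

theorem sigma_walk_ext {H : SimpleGraph V} {p q : Σ u : V, Σ v : V, H.Walk u v}
    (hlen : p.2.2.length = q.2.2.length)
    (h : ∀ i ≤ p.2.2.length, p.2.2.getVert i = q.2.2.getVert i) : p = q := by
  obtain ⟨u, v, p⟩ := p
  obtain ⟨u', v', q⟩ := q
  dsimp only at hlen h
  obtain rfl : u = u' := by simpa using h 0 (Nat.zero_le _)
  obtain rfl : v = v' := by
    have := h p.length le_rfl
    rwa [p.getVert_length, hlen, q.getVert_length] at this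
  rw [SimpleGraph.Walk.ext_getVert_le_length hlen h]

theorem alternating_mem_iff_odd {H : SimpleGraph V} {S : Set (Sym2 V)} {u v : V}
    {p : H.Walk u v} (hc : List.IsChain (fun e f => Xor (e ∈ S) (f ∈ S)) p.edges)
    (hh : ∀ e ∈ p.edges.head?, e ∉ S) {i : ℕ} (hi : i < p.length) :
    s(p.getVert i, p.getVert (i + 1)) ∈ S ↔ Odd i := by
  induction i with
  | zero =>
    have h0 : 0 < p.edges.length := by simpa using hi
    have := hh p.edges[0] (by simp [List.head?_eq_getElem?])
    rw [SimpleGraph.Walk.getElem_edges] at this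
    simpa using this
  | succ i ih =>
    have h := List.isChain_iff_getElem.1 hc i (by simpa using hi)
    rw [SimpleGraph.Walk.getElem_edges, SimpleGraph.Walk.getElem_edges,
      ih (by omega)] at h
    rw [Nat.odd_add_one]
    rcases h with h | h <;> tauto

/-- for odd `k ≥ 3`, the number of paths with exactly `k` edges that are
alternating w.r.t. `S` and whose first and last edges do not belong to `S` (counting
each path once per direction of traversal) is at most `(2|S|)^((k-1)/2) · Δ²`. -/
theorem alternating_path_count_bound [Fintype V] (H : SimpleGraph V)
    (S : Set (Sym2 V)) (hS : S ⊆ H.edgeSet) (k : ℕ) (hk : 3 ≤ k) (hodd : Odd k) :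
    {q : Σ u : V, Σ v : V, H.Walk u v |
        q.2.2.IsPath ∧ q.2.2.length = k ∧
        List.Chain' (fun e f => Xor' (e ∈ S) (f ∈ S)) q.2.2.edges ∧
        (∀ e ∈ q.2.2.edges.head?, e ∉ S) ∧
        (∀ e ∈ q.2.2.edges.getLast?, e ∉ S)}.ncard
      ≤ (2 * S.ncard) ^ ((k - 1) / 2) * H.maxDegree ^ 2 := by
  obtain ⟨m, rfl⟩ := hodd
  obtain ⟨f, hf, hinj⟩ := exists_neighbor_labelling H
  have hm : (2 * m + 1 - 1) / 2 = m := by omega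
  rw [hm]
  let D := Finset.univ.filter fun p : V × V => s(p.1, p.2) ∈ S
  let T : Finset ((Fin m → V × V) × ℕ × ℕ) := Fintype.piFinset (fun _ => D) ×ˢ
    Finset.range H.maxDegree ×ˢ Finset.range H.maxDegree
  have hT : T.card ≤ (2 * S.ncard) ^ m * H.maxDegree ^ 2 := by
    simp only [T, Finset.card_product, Fintype.card_piFinset_const, Finset.card_range, ← sq]
    gcongr
    exact ncard_ordered_pairs_le S
  refine le_trans ?_ hT
  rw [← Set.ncard_coe_finset T]
  refine Set.ncard_le_ncard_of_injOn (fun q =>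
    (fun j : Fin m => (q.2.2.getVert (2 * j + 1), q.2.2.getVert (2 * j + 2)),
      f (q.2.2.getVert 1) (q.2.2.getVert 0),
      f (q.2.2.getVert (2 * m)) (q.2.2.getVert (2 * m + 1)))) ?_ ?_ T.finite_toSet
  · rintro ⟨u, v, p⟩ ⟨-, hlen, hc, hh, -⟩
    dsimp only at hlen hc hh
    simp only [T, D, Finset.coe_product, Set.mem_prod, Finset.mem_coe, Fintype.mem_piFinset,
      Finset.mem_filter, Finset.mem_univ, true_and, Finset.mem_range]
    exact ⟨fun j => (alternating_mem_iff_odd hc hh (by omega)).2 ⟨j, rfl⟩,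
      hf _ _ (p.adj_getVert_succ (by omega)).symm, hf _ _ (p.adj_getVert_succ (by omega))⟩
  · intro p hp q hq hpq
    have hp' := hp.2.1
    have hq' := hq.2.1
    simp only [Prod.mk.injEq, funext_iff] at hpq
    obtain ⟨hd, h0, hl⟩ := hpq
    have hmid : ∀ i, 1 ≤ i → i ≤ 2 * m → p.2.2.getVert i = q.2.2.getVert i := by
      intro i h1 h2
      obtain ⟨j, rfl | rfl⟩ : ∃ j, i = 2 * j + 1 ∨ i = 2 * j + 2 := ⟨(i - 1) / 2, by omega⟩
      · exact (hd ⟨j, by omega⟩).1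
      · exact (hd ⟨j, by omega⟩).2
    have hfirst := hmid 1 (by omega) (by omega)
    have hlast := hmid (2 * m) (by omega) le_rfl
    refine sigma_walk_ext (hp'.trans hq'.symm) fun i hi => ?_
    rcases Nat.eq_zero_or_pos i with rfl | hi0
    · rw [← hfirst] at h0
      exact hinj _ _ _ (p.2.2.adj_getVert_succ (by omega)).symm
        (hfirst ▸ (q.2.2.adj_getVert_succ (by omega)).symm) h0
    · rcases Nat.lt_or_ge (2 * m) i with hi' | hi'
      · obtain rfl : i = 2 * m + 1 := by omega
        rw [← hlast] at hl
        exact hinj _ _ _ (p.2.2.adj_getVert_succ (by omega))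
          (hlast ▸ q.2.2.adj_getVert_succ (by omega)) hl
      · exact hmid i hi0 hi'
end WCAP
end
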